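/- arXiv:2310.03516 — 2 statements merged into one kernel-verified Lean document; each statement's English description precedes it below -/
import Mathlib

section
/- Let {K_i}_{i=1}^∞ be a bounded sequence of h-convex bodies in ℍ^{n+1}, i.e. there exists M > 0 with d(O,X) ≤ M for all X ∈ K_i and all i. Then there exists a subsequence {K_{i_k}} such that the horospherical support functions u(K_{i_k}, ·) converge uniformly on 𝕊^n to a continuous function. -/
noncomputable section

open Real MeasureTheory Filter Topology Set
open scoped ENNReal symmDiff

namespace Horo

/-- The Lorentzian inner product on ℝ^{n+2}:
`X·Y = Σ_{i=1}^{n+1} x_i y_i − x_{n+2} y_{n+2}`. -/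
def lprod (n : ℕ) (X Y : Fin (n + 2) → ℝ) : ℝ :=
  (∑ i : Fin (n + 1), X i.castSucc * Y i.castSucc) - X (Fin.last (n + 1)) * Y (Fin.last (n + 1))

/-- The hyperboloid model ℍ^{n+1} of hyperbolic space. -/
def Hyp (n : ℕ) : Set (Fin (n + 2) → ℝ) :=
  {X | lprod n X X = -1 ∧ 0 < X (Fin.last (n + 1))}

/-- The origin O = (0,…,0,1) of hyperbolic space. -/
def origin (n : ℕ) : Fin (n + 2) → ℝ := Fin.snoc (fun _ => 0) 1

/-- The unit sphere 𝕊^n ⊂ ℝ^{n+1}. -/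
def sph (n : ℕ) : Set (Fin (n + 1) → ℝ) := {e | ∑ i, e i ^ 2 = 1}

/-- The null vector (e,1) ∈ ℝ^{n+2} associated with e ∈ 𝕊^n. -/
def dir {n : ℕ} (e : Fin (n + 1) → ℝ) : Fin (n + 2) → ℝ := Fin.snoc e 1

/-- The geodesic distance d(X,Y) = arcosh(−X·Y) on the hyperboloid. -/
def dH (n : ℕ) (X Y : Fin (n + 2) → ℝ) : ℝ :=
  Real.log (-(lprod n X Y) + Real.sqrt ((lprod n X Y) ^ 2 - 1))

/-- The horosphere H_e(s) = {X ∈ ℍ^{n+1} : X·(e,1) = −e^s}. -/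
def horoSphere (n : ℕ) (e : Fin (n + 1) → ℝ) (s : ℝ) : Set (Fin (n + 2) → ℝ) :=
  {X ∈ Hyp n | lprod n X (dir e) = -Real.exp s}

/-- The open horo-ball B_e(s) = {X ∈ ℍ^{n+1} : 0 > X·(e,1) > −e^s}. -/
def horoBall (n : ℕ) (e : Fin (n + 1) → ℝ) (s : ℝ) : Set (Fin (n + 2) → ℝ) :=
  {X ∈ Hyp n | 0 > lprod n X (dir e) ∧ lprod n X (dir e) > -Real.exp s}

/-- The closed horo-ball B̄_e(s) = {X ∈ ℍ^{n+1} : 0 > X·(e,1) ≥ −e^s}. -/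
def horoBallCl (n : ℕ) (e : Fin (n + 1) → ℝ) (s : ℝ) : Set (Fin (n + 2) → ℝ) :=
  {X ∈ Hyp n | 0 > lprod n X (dir e) ∧ lprod n X (dir e) ≥ -Real.exp s}

/-- A set Ω ⊂ ℍ^{n+1} is horospherically convex (h-convex) if it is closed and every
relative boundary point of Ω admits a supporting horo-ball. -/
def IsHConvex (n : ℕ) (Ω : Set (Fin (n + 2) → ℝ)) : Prop :=
  Ω ⊆ Hyp n ∧ IsClosed Ω ∧
    ∀ X ∈ Ω ∩ closure (Hyp n \ Ω),
      ∃ e ∈ sph n, ∃ s : ℝ, Ω ⊆ horoBallCl n e s ∧ X ∈ horoSphere n e s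

/-- The interior of a subset of the hyperboloid, relative to the hyperboloid. -/
def relInt (n : ℕ) (K : Set (Fin (n + 2) → ℝ)) : Set (Fin (n + 2) → ℝ) :=
  {X ∈ Hyp n | ∃ ε > 0, ∀ Y ∈ Hyp n, dH n X Y < ε → Y ∈ K}

/-- A h-convex body: a compact h-convex set with nonempty (relative) interior. -/
def IsHConvexBody (n : ℕ) (K : Set (Fin (n + 2) → ℝ)) : Prop :=
  IsHConvex n K ∧ IsCompact K ∧ (relInt n K).Nonempty

/-- A h-convex polytope: a h-convex body which is a finite intersection of closed
horo-balls. -/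
def IsHPolytope (n : ℕ) (P : Set (Fin (n + 2) → ℝ)) : Prop :=
  IsHConvexBody n P ∧ ∃ m : ℕ, 2 ≤ m ∧ ∃ (e : Fin m → (Fin (n + 1) → ℝ)) (u : Fin m → ℝ),
    (∀ i, e i ∈ sph n) ∧ P = ⋂ i, horoBallCl n (e i) (u i)

/-- The horospherical support function u(K,e) = sup{log(−X·(e,1)) : X ∈ K}. -/
def suppFn (n : ℕ) (K : Set (Fin (n + 2) → ℝ)) (e : Fin (n + 1) → ℝ) : ℝ :=
  sSup ((fun X => Real.log (-(lprod n X (dir e)))) '' K)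

/-- The outer parallel set K^ε = {X ∈ ℍ^{n+1} : d(K,X) ≤ ε}. -/
def outPar (n : ℕ) (K : Set (Fin (n + 2) → ℝ)) (ε : ℝ) : Set (Fin (n + 2) → ℝ) :=
  {X ∈ Hyp n | ∃ Y ∈ K, dH n Y X ≤ ε}

/-- The Hausdorff distance d_H(K,L) = inf{ε ≥ 0 : K ⊆ L^ε and L ⊆ K^ε}. -/
def dHaus (n : ℕ) (K L : Set (Fin (n + 2) → ℝ)) : ℝ :=
  sInf {ε : ℝ | 0 ≤ ε ∧ K ⊆ outPar n L ε ∧ L ⊆ outPar n K ε}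

/-- The point (sinh r · θ, cosh r) ∈ ℍ^{n+1} at distance r from O in direction θ. -/
def rpt (n : ℕ) (θ : Fin (n + 1) → ℝ) (r : ℝ) : Fin (n + 2) → ℝ :=
  Fin.snoc (fun i => Real.sinh r * θ i) (Real.cosh r)

/-- The radial function ρ(K,θ) = max{λ ≥ 0 : (sinh λ · θ, cosh λ) ∈ K}. -/
def radFn (n : ℕ) (K : Set (Fin (n + 2) → ℝ)) (θ : Fin (n + 1) → ℝ) : ℝ :=
  sSup {r : ℝ | 0 ≤ r ∧ rpt n θ r ∈ K}

/-- R(K) = max_θ ρ(K,θ). -/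
def Rmax (n : ℕ) (K : Set (Fin (n + 2) → ℝ)) : ℝ := sSup (radFn n K '' sph n)

/-- r(K) = min_θ ρ(K,θ). -/
def rmin (n : ℕ) (K : Set (Fin (n + 2) → ℝ)) : ℝ := sInf (radFn n K '' sph n)

/-- The point reflection (x_1,…,x_{n+1},x_{n+2}) ↦ (−x_1,…,−x_{n+1},x_{n+2}) about O. -/
def symMap (n : ℕ) (X : Fin (n + 2) → ℝ) : Fin (n + 2) → ℝ :=
  fun i => if i = Fin.last (n + 1) then X i else -X i

/-- The hyperbolic (Riemannian) volume of a subset of the hyperboloid, computed via the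
graph parametrization x ↦ (x, √(1+|x|²)), whose volume density is 1/√(1+|x|²). -/
def hypVol (n : ℕ) (K : Set (Fin (n + 2) → ℝ)) : ℝ :=
  ∫ x : Fin (n + 1) → ℝ,
    Set.indicator {y : Fin (n + 1) → ℝ | Fin.snoc y (Real.sqrt (1 + ∑ i, y i ^ 2)) ∈ K}
      (fun y => 1 / Real.sqrt (1 + ∑ i, y i ^ 2)) x

/-- The distance from a point X to a set P. -/
def distTo (n : ℕ) (P : Set (Fin (n + 2) → ℝ)) (X : Fin (n + 2) → ℝ) : ℝ :=
  sInf ((fun Y => dH n Y X) '' P)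

/-- The facet F(P,e) = P ∩ H_e(u(P,e)). -/
def facet (n : ℕ) (P : Set (Fin (n + 2) → ℝ)) (e : Fin (n + 1) → ℝ) :
    Set (Fin (n + 2) → ℝ) :=
  P ∩ horoSphere n e (suppFn n P e)

/-- The relative interior of the facet F(P,e) inside the horosphere H_e(u(P,e)). -/
def facetRelInt (n : ℕ) (P : Set (Fin (n + 2) → ℝ)) (e : Fin (n + 1) → ℝ) :
    Set (Fin (n + 2) → ℝ) :=
  {Y ∈ facet n P e | ∃ δ > 0, ∀ Z ∈ horoSphere n e (suppFn n P e),
    dH n Y Z < δ → Z ∈ facet n P e}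

/-- The collar 𝒫_t(P, F̊(P,e)): points at positive distance ≤ t from P whose nearest
point in P lies in the relative interior of the facet F(P,e). -/
def collar (n : ℕ) (P : Set (Fin (n + 2) → ℝ)) (e : Fin (n + 1) → ℝ) (t : ℝ) :
    Set (Fin (n + 2) → ℝ) :=
  {X ∈ Hyp n | 0 < distTo n P X ∧ distTo n P X ≤ t ∧
    ∃ Y ∈ facetRelInt n P e, ∀ Z ∈ P, dH n Y X ≤ dH n Z X}

/-- The diameter of a set with respect to a distance function, in ℝ≥0∞. -/
def ediamWith {α : Type*} (d : α → α → ℝ) (U : Set α) : ℝ≥0∞ :=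
  ⨆ (x ∈ U) (y ∈ U), ENNReal.ofReal (d x y)

/-- The (unnormalized) s-dimensional Hausdorff measure associated with a distance
function d, via the Carathéodory construction. -/
def hMeasWith {α : Type*} (d : α → α → ℝ) (s : ℕ) (A : Set α) : ℝ≥0∞ :=
  ⨆ (δ : ℝ) (_ : 0 < δ),
    ⨅ (U : ℕ → Set α) (_ : A ⊆ ⋃ i, U i) (_ : ∀ i, ediamWith d (U i) ≤ ENNReal.ofReal δ),
      ∑' i, ediamWith d (U i) ^ s

/-- ω_n, the volume of the unit ball in ℝ^n. -/
def unitBallVol (n : ℕ) : ℝ :=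
  (volume (Metric.ball (0 : EuclideanSpace ℝ (Fin n)) 1)).toReal

/-- S(P,e): the n-dimensional area of the facet F(P,e), i.e. the normalized
n-dimensional Hausdorff measure of F(P,e) with respect to the hyperbolic distance. -/
def areaFacet (n : ℕ) (P : Set (Fin (n + 2) → ℝ)) (e : Fin (n + 1) → ℝ) : ℝ :=
  (ENNReal.ofReal (unitBallVol n / 2 ^ n) * hMeasWith (dH n) n (facet n P e)).toReal

lemma neg_lprod_dir (n : ℕ) (X : Fin (n + 2) → ℝ) (e : Fin (n + 1) → ℝ) :
    -(lprod n X (dir e)) = X (Fin.last (n + 1)) - ∑ i : Fin (n + 1), X i.castSucc * e i := by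
  simp [lprod, dir]

lemma sum_sq_of_mem_Hyp {n : ℕ} {X : Fin (n + 2) → ℝ} (hX : X ∈ Hyp n) :
    ∑ i : Fin (n + 1), X i.castSucc ^ 2 = X (Fin.last (n + 1)) ^ 2 - 1 := by
  have h := hX.1
  simp only [lprod, ← pow_two] at h
  linarith

lemma one_le_last_of_mem_Hyp {n : ℕ} {X : Fin (n + 2) → ℝ} (hX : X ∈ Hyp n) :
    1 ≤ X (Fin.last (n + 1)) := by
  have h : 0 ≤ ∑ i : Fin (n + 1), X i.castSucc ^ 2 := Finset.sum_nonneg fun i _ => sq_nonneg _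
  rw [sum_sq_of_mem_Hyp hX] at h
  nlinarith [hX.2]

lemma last_le_exp {n : ℕ} {X : Fin (n + 2) → ℝ} (hX : X ∈ Hyp n) {M : ℝ}
    (h : dH n (origin n) X ≤ M) : X (Fin.last (n + 1)) ≤ Real.exp M := by
  have h1 := one_le_last_of_mem_Hyp hX
  have hp : lprod n (origin n) X = -X (Fin.last (n + 1)) := by simp [lprod, origin]
  rw [dH, hp, neg_neg] at h
  have hs := Real.sqrt_nonneg ((-X (Fin.last (n + 1))) ^ 2 - 1)
  linarith [(Real.log_le_iff_le_exp (by linarith)).1 h]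

lemma sum_mul_sq_le {n : ℕ} {X : Fin (n + 2) → ℝ} (hX : X ∈ Hyp n)
    {e : Fin (n + 1) → ℝ} (he : e ∈ sph n) :
    (∑ i : Fin (n + 1), X i.castSucc * e i) ^ 2 ≤ X (Fin.last (n + 1)) ^ 2 - 1 := by
  have h := Finset.sum_mul_sq_le_sq_mul_sq Finset.univ (fun i : Fin (n + 1) => X i.castSucc) e
  rwa [sum_sq_of_mem_Hyp hX, show ∑ i, e i ^ 2 = 1 from he, mul_one] at h

lemma neg_lprod_dir_le {n : ℕ} {X : Fin (n + 2) → ℝ} (hX : X ∈ Hyp n)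
    {e : Fin (n + 1) → ℝ} (he : e ∈ sph n) {R : ℝ} (hR : X (Fin.last (n + 1)) ≤ R) :
    -(lprod n X (dir e)) ≤ 2 * R := by
  rw [neg_lprod_dir]
  have h := sum_mul_sq_le hX he
  have h1 := one_le_last_of_mem_Hyp hX
  have := abs_le_of_sq_le_sq' (h.trans (sub_le_self _ zero_le_one)) (by linarith)
  linarith [this.1]

lemma inv_le_neg_lprod_dir {n : ℕ} {X : Fin (n + 2) → ℝ} (hX : X ∈ Hyp n)
    {e : Fin (n + 1) → ℝ} (he : e ∈ sph n) {R : ℝ} (hR : X (Fin.last (n + 1)) ≤ R) :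
    (2 * R)⁻¹ ≤ -(lprod n X (dir e)) := by
  rw [neg_lprod_dir]
  have h := sum_mul_sq_le hX he
  have h1 := one_le_last_of_mem_Hyp hX
  have h2 := abs_le_of_sq_le_sq' (h.trans (sub_le_self _ zero_le_one)) (by linarith)
  rw [inv_le_iff_one_le_mul₀ (by linarith)]
  nlinarith [h2.1, h2.2]

lemma abs_lprod_dir_sub_le {n : ℕ} {X : Fin (n + 2) → ℝ} (hX : X ∈ Hyp n)
    (e e' : Fin (n + 1) → ℝ) {R : ℝ} (hR : X (Fin.last (n + 1)) ≤ R) :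
    -(lprod n X (dir e)) - -(lprod n X (dir e')) ≤ (n + 1) * R * dist e e' := by
  have h1 := one_le_last_of_mem_Hyp hX
  rw [neg_lprod_dir, neg_lprod_dir, sub_sub_sub_cancel_left, ← Finset.sum_sub_distrib]
  have key : ∀ i ∈ (Finset.univ : Finset (Fin (n + 1))),
      X i.castSucc * e' i - X i.castSucc * e i ≤ R * dist e e' := by
    intro i _
    have ha : |X i.castSucc| ≤ R := by
      refine le_trans (abs_le_of_sq_le_sq ?_ (by linarith)) hR
      have := Finset.single_le_sum (f := fun j : Fin (n + 1) => X j.castSucc ^ 2)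
        (fun j _ => sq_nonneg _) (Finset.mem_univ i)
      rw [sum_sq_of_mem_Hyp hX] at this
      linarith
    have hb : |e' i - e i| ≤ dist e e' := by
      rw [dist_comm, ← Real.dist_eq]
      exact dist_le_pi_dist e' e i
    rw [← mul_sub]
    refine (le_abs_self _).trans ?_
    rw [abs_mul]
    exact mul_le_mul ha hb (abs_nonneg _) (by linarith)
  refine (Finset.sum_le_sum key).trans (le_of_eq ?_)
  simp [mul_assoc]

/-- The Lipschitz constant of the horospherical support functions of sets lying in
`{x_{n+2} ≤ R}`. -/
def lipConst (n : ℕ) (R : ℝ) : ℝ := (n + 1) * R * (2 * R)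

lemma log_neg_lprod_dir_le {n : ℕ} {X : Fin (n + 2) → ℝ} (hX : X ∈ Hyp n)
    {e e' : Fin (n + 1) → ℝ} (he : e ∈ sph n) (he' : e' ∈ sph n) {R : ℝ}
    (hR : X (Fin.last (n + 1)) ≤ R) :
    Real.log (-(lprod n X (dir e))) ≤
      Real.log (-(lprod n X (dir e'))) + lipConst n R * dist e e' := by
  have h1 := one_le_last_of_mem_Hyp hX
  have hA := inv_le_neg_lprod_dir hX he hR
  have hB := inv_le_neg_lprod_dir hX he' hR
  have hd := abs_lprod_dir_sub_le hX e e' hR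
  set A := -(lprod n X (dir e))
  set B := -(lprod n X (dir e'))
  have hpos : 0 < (2 * R)⁻¹ := inv_pos.2 (by linarith)
  have hA0 : 0 < A := hpos.trans_le hA
  have hB0 : 0 < B := hpos.trans_le hB
  have hlog := Real.log_le_sub_one_of_pos (div_pos hA0 hB0)
  rw [Real.log_div hA0.ne' hB0.ne', div_sub_one hB0.ne'] at hlog
  have h2 : (A - B) / B ≤ lipConst n R * dist e e' := by
    rw [div_le_iff₀ hB0]
    have hn : 0 ≤ (n + 1) * R * dist e e' :=
      mul_nonneg (mul_nonneg (by positivity) (by linarith)) dist_nonneg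
    have : 1 ≤ 2 * R * B := by
      rwa [inv_le_iff_one_le_mul₀ (by linarith), mul_comm] at hB
    calc A - B ≤ (n + 1) * R * dist e e' * 1 := by linarith
      _ ≤ (n + 1) * R * dist e e' * (2 * R * B) := by gcongr
      _ = lipConst n R * dist e e' * B := by rw [lipConst]; ring
  linarith

lemma IsHConvexBody.nonempty {n : ℕ} {K : Set (Fin (n + 2) → ℝ)} (hK : IsHConvexBody n K) :
    K.Nonempty := by
  obtain ⟨X, hX, ε, hε, h⟩ := hK.2.2
  exact ⟨X, h X hX (by simpa [dH, hX.1] using hε)⟩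

section suppFn

variable {n : ℕ} {K : Set (Fin (n + 2) → ℝ)} {R : ℝ}

lemma log_neg_lprod_dir_le_log (hK : K ⊆ Hyp n) (hR : ∀ X ∈ K, X (Fin.last (n + 1)) ≤ R)
    {e : Fin (n + 1) → ℝ} (he : e ∈ sph n) {X : Fin (n + 2) → ℝ} (hX : X ∈ K) :
    Real.log (-(lprod n X (dir e))) ≤ Real.log (2 * R) := by
  have h1 := one_le_last_of_mem_Hyp (hK hX)
  have h2 := hR X hX
  have hp : 0 < (2 * R)⁻¹ := inv_pos.2 (by linarith)
  exact Real.log_le_log (hp.trans_le (inv_le_neg_lprod_dir (hK hX) he h2))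
    (neg_lprod_dir_le (hK hX) he h2)

lemma le_suppFn (hK : K ⊆ Hyp n) (hR : ∀ X ∈ K, X (Fin.last (n + 1)) ≤ R)
    {e : Fin (n + 1) → ℝ} (he : e ∈ sph n) {X : Fin (n + 2) → ℝ} (hX : X ∈ K) :
    Real.log (-(lprod n X (dir e))) ≤ suppFn n K e := by
  refine le_csSup ⟨Real.log (2 * R), ?_⟩ (mem_image_of_mem _ hX)
  rintro _ ⟨Y, hY, rfl⟩
  exact log_neg_lprod_dir_le_log hK hR he hY

lemma abs_suppFn_le (hne : K.Nonempty) (hK : K ⊆ Hyp n)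
    (hR : ∀ X ∈ K, X (Fin.last (n + 1)) ≤ R) {e : Fin (n + 1) → ℝ} (he : e ∈ sph n) :
    |suppFn n K e| ≤ Real.log (2 * R) := by
  rw [abs_le]
  constructor
  · obtain ⟨X, hX⟩ := hne
    have h1 := one_le_last_of_mem_Hyp (hK hX)
    have h2 := hR X hX
    rw [← Real.log_inv]
    exact (Real.log_le_log (inv_pos.2 (by linarith)) (inv_le_neg_lprod_dir (hK hX) he h2)).trans
      (le_suppFn hK hR he hX)
  · refine csSup_le (hne.image _) ?_
    rintro _ ⟨Y, hY, rfl⟩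
    exact log_neg_lprod_dir_le_log hK hR he hY

lemma suppFn_le_add (hne : K.Nonempty) (hK : K ⊆ Hyp n)
    (hR : ∀ X ∈ K, X (Fin.last (n + 1)) ≤ R) {e e' : Fin (n + 1) → ℝ}
    (he : e ∈ sph n) (he' : e' ∈ sph n) :
    suppFn n K e ≤ suppFn n K e' + lipConst n R * dist e e' := by
  refine csSup_le (hne.image _) ?_
  rintro _ ⟨X, hX, rfl⟩
  have h1 := log_neg_lprod_dir_le (hK hX) he he' (hR X hX)
  have h2 := le_suppFn hK hR he' hX
  linarith

lemma lipschitzWith_suppFn (hne : K.Nonempty) (hK : K ⊆ Hyp n)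
    (hR : ∀ X ∈ K, X (Fin.last (n + 1)) ≤ R) :
    LipschitzWith (lipConst n R).toNNReal (fun e : sph n => suppFn n K e) :=
  LipschitzWith.of_le_add_mul' _ fun e e' => suppFn_le_add hne hK hR e.2 e'.2

end suppFn

lemma isCompact_sph (n : ℕ) : IsCompact (sph n) := by
  refine Metric.isCompact_of_isClosed_isBounded ?_ ?_
  · exact isClosed_eq (by fun_prop) continuous_const
  · refine (Metric.isBounded_closedBall (x := (0 : Fin (n + 1) → ℝ)) (r := 1)).subset ?_
    intro e he
    rw [mem_closedBall_zero_iff, pi_norm_le_iff_of_nonneg zero_le_one]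
    intro i
    have h := Finset.single_le_sum (f := fun j => e j ^ 2)
      (fun j _ => sq_nonneg _) (Finset.mem_univ i)
    rw [show ∑ i, e i ^ 2 = 1 from he] at h
    exact (sq_le_one_iff_abs_le_one _).1 h

/-- A uniformly bounded, uniformly Lipschitz sequence of real functions on a compact set has
a subsequence that converges uniformly to a continuous function. -/
lemma exists_subseq_tendstoUniformlyOn_of_lipschitzWith {α : Type*} [PseudoMetricSpace α]
    {s : Set α} (hs : IsCompact s) (f : ℕ → α → ℝ) (C : ℝ) (L : NNReal)
    (hC : ∀ k, ∀ x ∈ s, |f k x| ≤ C) (hL : ∀ k, LipschitzWith L (fun x : s => f k x)) :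
    ∃ φ : ℕ → ℕ, StrictMono φ ∧ ∃ g : α → ℝ, ContinuousOn g s ∧
      TendstoUniformlyOn (fun k => f (φ k)) g atTop s := by
  have : CompactSpace s := isCompact_iff_compactSpace.1 hs
  let F : ℕ → BoundedContinuousFunction s ℝ := fun k =>
    BoundedContinuousFunction.mkOfCompact ⟨fun x : s => f k x, (hL k).continuous⟩
  have hcomp : IsCompact (closure (range F)) := by
    refine BoundedContinuousFunction.arzela_ascoli (Metric.closedBall (0 : ℝ) C)
      (isCompact_closedBall _ _) _ ?_ ?_
    · rintro _ x ⟨k, rfl⟩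
      simpa [F] using hC k x x.2
    · refine (LipschitzWith.uniformEquicontinuous _ L ?_).equicontinuous
      rintro ⟨_, k, rfl⟩
      exact hL k
  obtain ⟨G, -, φ, hφ, hG⟩ := hcomp.tendsto_subseq (x := F) fun k => subset_closure ⟨k, rfl⟩
  classical
  have hg : ∀ x : s, (fun x => if h : x ∈ s then G ⟨x, h⟩ else 0) (x : α) = G x := fun x => by simp
  refine ⟨φ, hφ, fun x => if h : x ∈ s then G ⟨x, h⟩ else 0, ?_, ?_⟩
  · rw [continuousOn_iff_continuous_domRestrict]
    exact G.continuous.congr fun x => (hg x).symm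
  · rw [tendstoUniformlyOn_iff_tendstoUniformly_comp_coe]
    rw [show (fun x => if h : x ∈ s then G ⟨x, h⟩ else 0) ∘ ((↑) : s → α) = G from funext hg]
    exact BoundedContinuousFunction.tendsto_iff_tendstoUniformly.1 hG

/-- **Selection theorem.** A bounded sequence of h-convex bodies admits a subsequence
whose horospherical support functions converge uniformly on 𝕊^n to a continuous
function. -/
theorem selection_suppFn (n : ℕ) (hn : 1 ≤ n)
    (K : ℕ → Set (Fin (n + 2) → ℝ)) (hK : ∀ i, IsHConvexBody n (K i))
    (M : ℝ) (hM : 0 < M) (hbd : ∀ i, ∀ X ∈ K i, dH n (origin n) X ≤ M) :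
    ∃ φ : ℕ → ℕ, StrictMono φ ∧ ∃ u₀ : (Fin (n + 1) → ℝ) → ℝ,
      ContinuousOn u₀ (sph n) ∧
      TendstoUniformlyOn (fun k => suppFn n (K (φ k))) u₀ atTop (sph n) := by
  have hR : ∀ i, ∀ X ∈ K i, X (Fin.last (n + 1)) ≤ Real.exp M :=
    fun i X hX => last_le_exp ((hK i).1.1 hX) (hbd i X hX)
  exact exists_subseq_tendstoUniformlyOn_of_lipschitzWith (isCompact_sph n)
    (fun i => suppFn n (K i)) _ _
    (fun i _ he => abs_suppFn_le (hK i).nonempty (hK i).1.1 (hR i) he)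
    (fun i => lipschitzWith_suppFn (hK i).nonempty (hK i).1.1 (hR i))

end Horo
end
end

section
/- (Separating horosphere theorem.) Let K be a h-convex body in ℍ^{n+1} and let Q ∈ ℍ^{n+1} be a point with Q ∉ K. Then there exist e ∈ 𝕊^n and s ∈ ℝ such that the horosphere H_e(s) separates K and Q, i.e. K ⊂ B̄_e(s) and Q ∉ B̄_e(s). -/
noncomputable section

open Real MeasureTheory Filter Topology Set
open scoped ENNReal symmDiff

namespace Horo

theorem lprod_comm (n : ℕ) (X Y : Fin (n + 2) → ℝ) : lprod n X Y = lprod n Y X := by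
  simp only [lprod, mul_comm]

theorem lprod_add_smul_left (n : ℕ) (a b : ℝ) (X Y Z : Fin (n + 2) → ℝ) :
    lprod n (a • X + b • Y) Z = a * lprod n X Z + b * lprod n Y Z := by
  simp only [lprod, Pi.add_apply, Pi.smul_apply, smul_eq_mul, add_mul, Finset.sum_add_distrib,
    mul_sub, Finset.mul_sum, mul_assoc]
  ring

theorem lprod_add_smul_self (n : ℕ) (a b : ℝ) (X Y : Fin (n + 2) → ℝ) :
    lprod n (a • X + b • Y) (a • X + b • Y) =
      a ^ 2 * lprod n X X + 2 * a * b * lprod n X Y + b ^ 2 * lprod n Y Y := by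
  rw [lprod_add_smul_left, lprod_comm n X, lprod_comm n Y, lprod_add_smul_left,
    lprod_add_smul_left, lprod_comm n Y X]
  ring

theorem lprod_smul_left (n : ℕ) (a : ℝ) (X Y : Fin (n + 2) → ℝ) :
    lprod n (a • X) Y = a * lprod n X Y := by
  simpa using lprod_add_smul_left n a 0 X 0 Y

theorem lprod_dir_self (n : ℕ) {e : Fin (n + 1) → ℝ} (he : e ∈ sph n) :
    lprod n (dir e) (dir e) = 0 := by
  have h : ∑ i, e i ^ 2 = 1 := he
  simp [lprod, dir, ← pow_two, h]

/-- The reversed Cauchy–Schwarz inequality on the hyperboloid. -/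
theorem lprod_le_neg_one (n : ℕ) {X Y : Fin (n + 2) → ℝ} (hX : X ∈ Hyp n) (hY : Y ∈ Hyp n) :
    lprod n X Y ≤ -1 := by
  obtain ⟨hX, hX0⟩ := hX
  obtain ⟨hY, hY0⟩ := hY
  have hcs := Finset.sum_mul_sq_le_sq_mul_sq Finset.univ
    (fun i : Fin (n + 1) => X i.castSucc) (fun i => Y i.castSucc)
  have hXs : 0 ≤ ∑ i : Fin (n + 1), X i.castSucc ^ 2 := Finset.sum_nonneg fun i _ => sq_nonneg _
  have hYs : 0 ≤ ∑ i : Fin (n + 1), Y i.castSucc ^ 2 := Finset.sum_nonneg fun i _ => sq_nonneg _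
  simp only [lprod, ← pow_two] at hX hY ⊢
  set x := X (Fin.last (n + 1))
  set y := Y (Fin.last (n + 1))
  rw [show ∑ i : Fin (n + 1), X i.castSucc ^ 2 = x ^ 2 - 1 by linarith] at hcs hXs
  rw [show ∑ i : Fin (n + 1), Y i.castSucc ^ 2 = y ^ 2 - 1 by linarith] at hcs hYs
  have hx : 1 ≤ x := by nlinarith
  have hy : 1 ≤ y := by nlinarith
  have := abs_le_of_sq_le_sq' (a := ∑ i : Fin (n + 1), X i.castSucc * Y i.castSucc)
    (b := x * y - 1) (by nlinarith [sq_nonneg (x - y)]) (by nlinarith)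
  linarith [this.2]

/-- A unit timelike vector pairing negatively with a future null vector is future-directed. -/
theorem mem_hyp_of_lprod_dir_neg (n : ℕ) {e : Fin (n + 1) → ℝ} (he : e ∈ sph n)
    {X : Fin (n + 2) → ℝ} (hX : lprod n X X = -1) (hXe : lprod n X (dir e) < 0) : X ∈ Hyp n := by
  refine ⟨hX, ?_⟩
  have hcs := Finset.sum_mul_sq_le_sq_mul_sq Finset.univ (fun i : Fin (n + 1) => X i.castSucc) e
  rw [show ∑ i, e i ^ 2 = 1 from he] at hcs
  simp only [lprod, dir, ← pow_two, Fin.snoc_castSucc, Fin.snoc_last, mul_one] at hX hXe hcs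
  by_contra! h
  nlinarith

/-- The point at distance `r` from `p` on the geodesic issuing from the ideal point `e`. -/
theorem exists_lprod_dir_eq_mul_exp (n : ℕ) {e : Fin (n + 1) → ℝ} (he : e ∈ sph n)
    {p : Fin (n + 2) → ℝ} (hp : p ∈ Hyp n) (hpe : lprod n p (dir e) < 0) {r : ℝ} (hr : 0 ≤ r) :
    ∃ Y ∈ Hyp n, dH n p Y = r ∧ lprod n Y (dir e) = lprod n p (dir e) * Real.exp r := by
  have hE := lprod_dir_self n he
  have hpp : lprod n p p = -1 := hp.1
  set f := lprod n p (dir e) with hf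
  have hf0 : f ≠ 0 := hpe.ne
  have hsum : Real.exp r = Real.cosh r + Real.sinh r := (Real.cosh_add_sinh r).symm
  have hcs := Real.cosh_sq r
  have hYe : lprod n (Real.exp r • p + (Real.sinh r / f) • dir e) (dir e) = f * Real.exp r := by
    rw [lprod_add_smul_left, hE, ← hf]
    ring
  refine ⟨Real.exp r • p + (Real.sinh r / f) • dir e, ?_, ?_, hYe⟩
  · refine mem_hyp_of_lprod_dir_neg n he ?_ ?_
    · rw [lprod_add_smul_self, hE, hpp, ← hf, hsum]
      field_simp
      linear_combination -f ^ 2 * hcs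
    · rw [hYe]
      exact mul_neg_of_neg_of_pos hpe (Real.exp_pos r)
  · have hpY : lprod n p (Real.exp r • p + (Real.sinh r / f) • dir e) = -Real.cosh r := by
      rw [lprod_comm, lprod_add_smul_left, lprod_comm n (dir e), hpp, ← hf, hsum]
      field_simp
      ring
    rw [dH, hpY, show (-Real.cosh r) ^ 2 - 1 = Real.sinh r ^ 2 by linear_combination hcs,
      Real.sqrt_sq (Real.sinh_nonneg_iff.2 hr), neg_neg, Real.cosh_add_sinh, Real.log_exp]

/-- A relative interior point of a set lies strictly inside any closed horo-ball containing it. -/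
theorem relInt_subset_horoBall (n : ℕ) {e : Fin (n + 1) → ℝ} (he : e ∈ sph n) {s : ℝ}
    {K : Set (Fin (n + 2) → ℝ)} (hK : K ⊆ horoBallCl n e s) (hKH : K ⊆ Hyp n) :
    K ∩ relInt n K ⊆ horoBall n e s := by
  rintro p ⟨hpK, -, ε, hε, hball⟩
  have hp := hKH hpK
  obtain ⟨-, hp0, -⟩ := hK hpK
  obtain ⟨Y, hY, hd, hYe⟩ := exists_lprod_dir_eq_mul_exp n he hp hp0 (half_pos hε).le
  obtain ⟨-, -, hYs⟩ := hK (hball Y hY (by linarith))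
  refine ⟨hp, hp0, ?_⟩
  have := Real.one_lt_exp_iff.2 (half_pos hε)
  rw [hYe] at hYs
  nlinarith

/-- The normalized segment, a parametrization of the geodesic segment from `p` to `q`. -/
def geodesicSeg (n : ℕ) (p q : Fin (n + 2) → ℝ) (t : ℝ) : Fin (n + 2) → ℝ :=
  (√(-lprod n ((1 - t) • p + t • q) ((1 - t) • p + t • q)))⁻¹ • ((1 - t) • p + t • q)

theorem one_le_neg_lprod_segment (n : ℕ) {p q : Fin (n + 2) → ℝ} (hp : p ∈ Hyp n)
    (hq : q ∈ Hyp n) {t : ℝ} (ht : t ∈ Icc (0 : ℝ) 1) :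
    1 ≤ -lprod n ((1 - t) • p + t • q) ((1 - t) • p + t • q) := by
  rw [lprod_add_smul_self, hp.1, hq.1]
  nlinarith [mul_nonneg (mul_nonneg ht.1 (sub_nonneg.2 ht.2))
    (sub_nonneg.2 (lprod_le_neg_one n hp hq))]

theorem geodesicSeg_mem_hyp (n : ℕ) {p q : Fin (n + 2) → ℝ} (hp : p ∈ Hyp n)
    (hq : q ∈ Hyp n) {t : ℝ} (ht : t ∈ Icc (0 : ℝ) 1) : geodesicSeg n p q t ∈ Hyp n := by
  have h1 := one_le_neg_lprod_segment n hp hq ht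
  have hs := Real.sq_sqrt (zero_le_one.trans h1)
  have hs0 := Real.sqrt_pos.2 (zero_lt_one.trans_le h1)
  refine ⟨?_, ?_⟩
  · rw [geodesicSeg, lprod_smul_left, lprod_comm n ((1 - t) • p + t • q) (_ • _), lprod_smul_left]
    set Z := lprod n ((1 - t) • p + t • q) ((1 - t) • p + t • q)
    field_simp
    linarith
  · have hp0 := hp.2
    have hq0 := hq.2
    simp only [geodesicSeg, Pi.smul_apply, Pi.add_apply, smul_eq_mul]
    refine mul_pos (inv_pos.2 hs0) ?_
    rcases ht.1.eq_or_lt with rfl | h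
    · simpa using hp0
    · nlinarith [mul_nonneg (sub_nonneg.2 ht.2) hp0.le, mul_pos h hq0]

theorem geodesicSeg_zero (n : ℕ) {p q : Fin (n + 2) → ℝ} (hp : p ∈ Hyp n) :
    geodesicSeg n p q 0 = p := by
  simp [geodesicSeg, hp.1]

theorem geodesicSeg_one (n : ℕ) {p q : Fin (n + 2) → ℝ} (hq : q ∈ Hyp n) :
    geodesicSeg n p q 1 = q := by
  simp [geodesicSeg, hq.1]

theorem continuousOn_geodesicSeg (n : ℕ) {p q : Fin (n + 2) → ℝ} (hp : p ∈ Hyp n)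
    (hq : q ∈ Hyp n) : ContinuousOn (geodesicSeg n p q) (Icc 0 1) := by
  unfold geodesicSeg
  refine ContinuousOn.smul (f := fun t => (√(-lprod n ((1 - t) • p + t • q)
    ((1 - t) • p + t • q)))⁻¹) (g := fun t => (1 - t) • p + t • q)
    (ContinuousOn.inv₀ ?_ fun t ht => ?_) (by fun_prop)
  · simp only [lprod_add_smul_self]
    fun_prop
  · exact (Real.sqrt_pos.2 (zero_lt_one.trans_le (one_le_neg_lprod_segment n hp hq ht))).ne'

/-- Horo-balls are strictly convex along half-open geodesic segments. -/
theorem geodesicSeg_mem_horoBall (n : ℕ) {e : Fin (n + 1) → ℝ} {s : ℝ}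
    {p q : Fin (n + 2) → ℝ} (hp : p ∈ horoBall n e s) (hq : q ∈ horoBallCl n e s) {t : ℝ}
    (ht : t ∈ Ico (0 : ℝ) 1) : geodesicSeg n p q t ∈ horoBall n e s := by
  have ht' := Ico_subset_Icc_self ht
  have h1 := Real.one_le_sqrt.2 (one_le_neg_lprod_segment n hp.1 hq.1 ht')
  have hlt := sub_pos.2 ht.2
  have hneg : (1 - t) * lprod n p (dir e) + t * lprod n q (dir e) < 0 := by
    nlinarith [mul_pos hlt (neg_pos.2 hp.2.1), mul_nonneg ht.1 (neg_pos.2 hq.2.1).le]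
  have hgt : -Real.exp s < (1 - t) * lprod n p (dir e) + t * lprod n q (dir e) := by
    nlinarith [mul_lt_mul_of_pos_left hp.2.2 hlt, mul_le_mul_of_nonneg_left hq.2.2 ht.1]
  refine ⟨geodesicSeg_mem_hyp n hp.1 hq.1 ht', ?_⟩
  rw [geodesicSeg, lprod_smul_left, lprod_add_smul_left n (1 - t) t p q (dir e)]
  have hi := inv_pos.2 (zero_lt_one.trans_le h1)
  have hi1 := inv_le_one_of_one_le₀ h1
  exact ⟨mul_neg_of_pos_of_neg hi hneg, by nlinarith⟩

/-- A geodesic segment from a point of a closed set `K` to a point outside `K` meets the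
relative boundary of `K` before its endpoint. -/
theorem exists_geodesicSeg_mem_boundary (n : ℕ) {K : Set (Fin (n + 2) → ℝ)} (hK : IsClosed K)
    {p q : Fin (n + 2) → ℝ} (hp : p ∈ Hyp n) (hq : q ∈ Hyp n) (hpK : p ∈ K) (hqK : q ∉ K) :
    ∃ t ∈ Ico (0 : ℝ) 1, geodesicSeg n p q t ∈ K ∩ closure (Hyp n \ K) := by
  have hcont := continuousOn_geodesicSeg n hp hq
  have hcomp : IsCompact (Icc (0 : ℝ) 1 ∩ geodesicSeg n p q ⁻¹' K) :=
    isCompact_Icc.of_isClosed_subset (hcont.preimage_isClosed_of_isClosed isClosed_Icc hK)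
      inter_subset_left
  obtain ⟨t, ⟨ht, htK⟩, hmax⟩ := hcomp.exists_isGreatest
    ⟨0, left_mem_Icc.2 zero_le_one, by rwa [mem_preimage, geodesicSeg_zero n hp]⟩
  have ht1 : t < 1 := ht.2.lt_of_ne (by
    rintro rfl
    exact hqK (by rwa [mem_preimage, geodesicSeg_one n hq] at htK))
  have hsub : Ioo t 1 ⊆ Icc 0 1 := fun x hx => ⟨ht.1.trans hx.1.le, hx.2.le⟩
  refine ⟨t, ⟨ht.1, ht1⟩, htK, ((hcont t ht).mono hsub).mem_closure ?_ fun x hx =>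
    ⟨geodesicSeg_mem_hyp n hp hq (hsub hx), fun hxK => ?_⟩⟩
  · rw [closure_Ioo ht1.ne]
    exact left_mem_Icc.2 ht1.le
  · exact hx.1.not_ge (hmax ⟨hsub hx, hxK⟩)

/-- **Separating horosphere theorem.** If `K` is a h-convex body in ℍ^{n+1} and `Q` is
a point of ℍ^{n+1} outside `K`, there is a horosphere `H_e(s)` separating them:
`K ⊆ B̄_e(s)` and `Q ∉ B̄_e(s)`. -/
theorem separating_horosphere (n : ℕ) (hn : 1 ≤ n)
    (K : Set (Fin (n + 2) → ℝ)) (hK : IsHConvexBody n K)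
    (Q : Fin (n + 2) → ℝ) (hQ : Q ∈ Hyp n) (hQK : Q ∉ K) :
    ∃ e ∈ sph n, ∃ s : ℝ, K ⊆ horoBallCl n e s ∧ Q ∉ horoBallCl n e s := by
  obtain ⟨⟨hKH, hKc, hsupp⟩, -, p, hp⟩ := hK
  have hpK : p ∈ K := by
    obtain ⟨hpH, ε, hε, hball⟩ := hp
    exact hball p hpH (by simpa [dH, hpH.1] using hε)
  obtain ⟨t, ht, hX⟩ := exists_geodesicSeg_mem_boundary n hKc hp.1 hQ hpK hQK
  obtain ⟨e, he, s, hKs, -, hXs⟩ := hsupp _ hX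
  refine ⟨e, he, s, hKs, fun hQs => ?_⟩
  have hpB := relInt_subset_horoBall n he hKs hKH ⟨hpK, hp⟩
  exact (geodesicSeg_mem_horoBall n hpB hQs ht).2.2.ne' hXs

end Horo
end
end
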